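/- arXiv:2510.00016 — 5 statements merged into one kernel-verified Lean document; each statement's English description precedes it below -/
import Mathlib

section
/- Let p be an odd prime and k a field of characteristic p. Then for every x ∈ k one has £₁(x) = £₁(1−x), i.e. Σ_{i=1}^{p−1} x^i/i = Σ_{i=1}^{p−1} (1−x)^i/i. -/
/-- Kontsevich's 1½-logarithm `£₁(s) = Σ_{i=1}^{p−1} s^i / i`. -/
noncomputable def kontsevichLog (p : ℕ) {k : Type*} [Field k] (s : k) : k :=
  ∑ i ∈ Finset.Icc 1 (p - 1), s ^ i / (i : k)

/-- The sum `Σ_{i=1}^{p−1} (-1)^i (p choose i)/p s^i`, an integral lift of `-£₁` when `p` is prime. -/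
def binomialQuotientSum (p : ℕ) {R : Type*} [CommRing R] (s : R) : R :=
  ∑ i ∈ Finset.Icc 1 (p - 1), (-1) ^ i * ((p.choose i / p : ℕ) : R) * s ^ i

theorem natCast_mul_binomialQuotientSum {p : ℕ} (hp : p.Prime) (hodd : Odd p)
    {R : Type*} [CommRing R] (s : R) :
    (p : R) * binomialQuotientSum p s = (1 - s) ^ p + s ^ p - 1 := by
  have expand : (1 - s) ^ p = ∑ i ∈ Finset.range (p + 1), (-1) ^ i * (p.choose i : R) * s ^ i := by
    rw [sub_eq_neg_add, add_pow]
    refine Finset.sum_congr rfl fun i _ => ?_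
    rw [neg_pow, one_pow]
    ring
  have interior : (p : R) * binomialQuotientSum p s =
      ∑ i ∈ Finset.Ico 1 p, (-1) ^ i * (p.choose i : R) * s ^ i := by
    have hset : Finset.Icc 1 (p - 1) = Finset.Ico 1 p := by
      ext i
      simp only [Finset.mem_Icc, Finset.mem_Ico]
      have := hp.pos
      omega
    rw [binomialQuotientSum, hset, Finset.mul_sum]
    refine Finset.sum_congr rfl fun i hi => ?_
    obtain ⟨h1, h2⟩ := Finset.mem_Ico.mp hi
    have hdvd : p ∣ p.choose i := hp.dvd_choose_self (by omega) h2
    have hcast : (p : R) * ((p.choose i / p : ℕ) : R) = (p.choose i : R) := by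
      rw [← Nat.cast_mul, Nat.mul_div_cancel' hdvd]
    rw [← hcast]
    ring
  rw [interior, expand, Finset.sum_range_succ, Finset.range_eq_Ico,
    Finset.sum_eq_sum_Ico_succ_bot hp.pos]
  simp [hodd.neg_one_pow]

theorem binomialQuotientSum_map (p : ℕ) {R S : Type*} [CommRing R] [CommRing S] (f : R →+* S)
    (s : R) : f (binomialQuotientSum p s) = binomialQuotientSum p (f s) := by
  simp [binomialQuotientSum]

theorem binomialQuotientSum_one_sub {p : ℕ} (hp : p.Prime) (hodd : Odd p)
    {R : Type*} [CommRing R] (s : R) :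
    binomialQuotientSum p s = binomialQuotientSum p (1 - s) := by
  have generic : binomialQuotientSum p (Polynomial.X : Polynomial ℤ) =
      binomialQuotientSum p (1 - Polynomial.X) := by
    refine mul_left_cancel₀ (Nat.cast_ne_zero.mpr hp.ne_zero : (p : Polynomial ℤ) ≠ 0) ?_
    rw [natCast_mul_binomialQuotientSum hp hodd, natCast_mul_binomialQuotientSum hp hodd]
    ring
  have := congrArg (Polynomial.aeval s : Polynomial ℤ →ₐ[ℤ] R).toRingHom generic
  simpa [binomialQuotientSum_map] using this

theorem natCast_choose_prime_sub_one {p : ℕ} (hp : p.Prime) {R : Type*} [CommRing R] [CharP R p]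
    {j : ℕ} (hj : j < p) : ((p - 1).choose j : R) = (-1) ^ j := by
  induction j with
  | zero => simp
  | succ j ih =>
    have pascal := Nat.choose_succ_succ (p - 1) j
    rw [Nat.succ_eq_add_one, Nat.sub_add_cancel hp.one_le] at pascal
    have hzero : (p.choose (j + 1) : R) = 0 :=
      (CharP.cast_eq_zero_iff R p _).mpr (hp.dvd_choose_self (by omega) hj)
    rw [pascal, Nat.cast_add, ih (by omega)] at hzero
    rw [pow_succ]
    linear_combination hzero

theorem kontsevichLog_eq_neg_binomialQuotientSum {p : ℕ} (hp : p.Prime)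
    {k : Type*} [Field k] [CharP k p] (s : k) :
    kontsevichLog p s = -binomialQuotientSum p s := by
  rw [kontsevichLog, binomialQuotientSum, ← Finset.sum_neg_distrib]
  refine Finset.sum_congr rfl fun i hi => ?_
  obtain ⟨h1, h2⟩ := Finset.mem_Icc.mp hi
  have hpos := hp.pos
  obtain ⟨j, rfl⟩ : ∃ j, i = j + 1 := ⟨i - 1, by omega⟩
  have hne : ((j + 1 : ℕ) : k) ≠ 0 := fun h =>
    Nat.not_dvd_of_pos_of_lt (by omega) (by omega) ((CharP.cast_eq_zero_iff k p _).mp h)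
  have absorb : (p.choose (j + 1) / p) * (j + 1) = (p - 1).choose j := by
    have hdvd : p ∣ p.choose (j + 1) := hp.dvd_choose_self (by omega) (by omega)
    have h := Nat.add_one_mul_choose_eq (p - 1) j
    rw [Nat.sub_add_cancel hp.one_le] at h
    refine Nat.eq_of_mul_eq_mul_left hpos ?_
    rw [← mul_assoc, Nat.mul_div_cancel' hdvd, h]
  have hcoeff := congrArg (Nat.cast : ℕ → k) absorb
  rw [Nat.cast_mul, natCast_choose_prime_sub_one hp (by omega)] at hcoeff
  have hsq : ((-1 : k) ^ j) * (-1) ^ j = 1 := by rw [← mul_pow]; simp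
  rw [div_eq_iff hne, pow_succ (-1 : k)]
  linear_combination (-(-1) ^ j * s ^ (j + 1)) * hcoeff - s ^ (j + 1) * hsq

/-- `£₁(x) = £₁(1 − x)` in characteristic `p`. -/
theorem kontsevichLog_one_sub (p : ℕ) (hp : p.Prime) (hodd : Odd p)
    (k : Type*) [Field k] [CharP k p] (x : k) :
    kontsevichLog p x = kontsevichLog p (1 - x) := by
  rw [kontsevichLog_eq_neg_binomialQuotientSum hp, kontsevichLog_eq_neg_binomialQuotientSum hp,
    binomialQuotientSum_one_sub hp hodd]
end

section
/- Let p be an odd prime and k a field of characteristic p. Then for every x ∈ k with x ≠ 0 one has £₁(x) = −x^p · £₁(1/x). -/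
/-- `£₁(x) = −x^p · £₁(1/x)` in characteristic `p`, for `x ≠ 0`. -/
theorem kontsevichLog_inv (p : ℕ) (hp : p.Prime) (hodd : Odd p)
    (k : Type*) [Field k] [CharP k p] (x : k) (hx : x ≠ 0) :
    kontsevichLog p x = -x ^ p * kontsevichLog p x⁻¹ := by
  unfold kontsevichLog
  rw [Finset.mul_sum]
  refine Finset.sum_bij' (fun i _ => p - i) (fun i _ => p - i) ?_ ?_ ?_ ?_ ?_
  · intro i hi
    rw [Finset.mem_Icc] at hi ⊢
    lia
  · intro i hi
    rw [Finset.mem_Icc] at hi ⊢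
    lia
  · intro i hi
    rw [Finset.mem_Icc] at hi
    lia
  · intro i hi
    rw [Finset.mem_Icc] at hi
    lia
  · intro i hi
    rw [Finset.mem_Icc] at hi
    have hip : i ≤ p := by lia
    have hpow : x ^ p = x ^ i * x ^ (p - i) := by rw [← pow_add, Nat.add_sub_cancel' hip]
    rw [Nat.cast_sub hip, CharP.cast_eq_zero k p, zero_sub, div_neg, inv_pow, hpow, neg_mul_neg,
      ← mul_div_assoc, mul_inv_cancel_right₀ (pow_ne_zero _ hx)]
end

section
/- (Kontsevich's four-term functional equation.) Let p be an odd prime and k a field of characteristic p. For all r, s ∈ k with r(1−r)·s(1−s)·(s−r) ≠ 0, one has £₁(r) − £₁(s) + r^p·£₁(s/r) + (s−1)^p·£₁((1−r)/(1−s)) = 0. -/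
open Finset

/-- The polynomial `((x + y) ^ p - x ^ p - y ^ p) / p`, evaluated in a commutative ring. -/
def fermatCocycle (p : ℕ) {R : Type*} [CommRing R] (x y : R) : R :=
  ∑ i ∈ Ioo 0 p, x ^ i * y ^ (p - i) * ↑(p.choose i / p)

lemma map_fermatCocycle (p : ℕ) {R S : Type*} [CommRing R] [CommRing S] (f : R →+* S) (x y : R) :
    f (fermatCocycle p x y) = fermatCocycle p (f x) (f y) := by
  simp [fermatCocycle]

lemma mul_fermatCocycle {p : ℕ} (hp : p.Prime) {R : Type*} [CommRing R] (x y : R) :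
    p * fermatCocycle p x y = (x + y) ^ p - x ^ p - y ^ p := by
  rw [add_pow_prime_eq' hp x y, fermatCocycle]
  ring

/-- The four-term relation for `fermatCocycle`, in a ring where `p` can be cancelled. -/
lemma fermatCocycle_four_term_of_cast_ne_zero {p : ℕ} (hp : p.Prime) (hodd : Odd p)
    {R : Type*} [CommRing R] [IsDomain R] (hpR : (p : R) ≠ 0) (r s : R) :
    fermatCocycle p (-r) 1 - fermatCocycle p (-s) 1 + fermatCocycle p (-s) r
      - fermatCocycle p (-(1 - r)) (1 - s) = 0 := by
  refine (mul_eq_zero.1 ?_).resolve_left hpR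
  simp only [mul_sub, mul_add, mul_fermatCocycle hp, hodd.neg_pow]
  ring

lemma fermatCocycle_four_term {p : ℕ} (hp : p.Prime) (hodd : Odd p)
    {R : Type*} [CommRing R] (r s : R) :
    fermatCocycle p (-r) 1 - fermatCocycle p (-s) 1 + fermatCocycle p (-s) r
      - fermatCocycle p (-(1 - r)) (1 - s) = 0 := by
  have universal := congrArg (MvPolynomial.eval₂Hom (Int.castRingHom R) ![r, s])
    (fermatCocycle_four_term_of_cast_ne_zero hp hodd
      (Nat.cast_ne_zero.2 hp.ne_zero) (MvPolynomial.X 0 : MvPolynomial (Fin 2) ℤ)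
      (MvPolynomial.X 1))
  simp only [map_sub, map_add, map_neg, map_one, map_zero, map_fermatCocycle,
    MvPolynomial.eval₂Hom_X'] at universal
  simpa using universal

lemma cast_choose_prime_sub_one {p : ℕ} (hp : p.Prime) {R : Type*} [CommRing R] [CharP R p]
    {i : ℕ} (hi : i < p) : ((p - 1).choose i : R) = (-1) ^ i := by
  induction i with
  | zero => simp
  | succ i ih =>
    have pascal : p.choose (i + 1) = (p - 1).choose i + (p - 1).choose (i + 1) :=
      Nat.choose_eq_choose_pred_add hp.pos i.succ_pos
    have vanish : (p.choose (i + 1) : R) = 0 :=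
      (CharP.cast_eq_zero_iff R p _).2 (hp.dvd_choose_self i.succ_ne_zero hi)
    rw [pascal, Nat.cast_add, ih (by lia)] at vanish
    linear_combination vanish

/-- In characteristic `p`, `(p choose i) / p` equals `(-1) ^ (i - 1) / i`. -/
lemma cast_choose_prime_div {p : ℕ} (hp : p.Prime) {k : Type*} [Field k] [CharP k p]
    {i : ℕ} (hi₀ : 0 < i) (hi : i < p) :
    ((p.choose i / p : ℕ) : k) = (-1) ^ (i - 1) / (i : k) := by
  have hik : (i : k) ≠ 0 := fun h =>
    Nat.not_dvd_of_pos_of_lt hi₀ hi ((CharP.cast_eq_zero_iff k p i).1 h)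
  have absorb : p.choose i / p * i = (p - 1).choose (i - 1) := by
    have h := Nat.add_one_mul_choose_eq (p - 1) (i - 1)
    rw [Nat.sub_add_cancel hp.one_le, Nat.sub_add_cancel hi₀] at h
    refine Nat.eq_of_mul_eq_mul_left hp.pos ?_
    rw [h, ← mul_assoc, Nat.mul_div_cancel' (hp.dvd_choose_self hi₀.ne' hi)]
  rw [eq_div_iff hik, ← cast_choose_prime_sub_one hp (by lia), ← absorb, Nat.cast_mul]

lemma pow_mul_kontsevichLog_div {p : ℕ} (hp : p.Prime) {k : Type*} [Field k] [CharP k p]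
    (x : k) {y : k} (hy : y ≠ 0) :
    y ^ p * kontsevichLog p (x / y) = -fermatCocycle p (-x) y := by
  have hIcc : Icc 1 (p - 1) = Ioo 0 p := by
    ext i
    simp only [mem_Icc, mem_Ioo]
    lia
  rw [kontsevichLog, fermatCocycle, hIcc, mul_sum, ← sum_neg_distrib]
  refine sum_congr rfl fun i hi => ?_
  obtain ⟨hi₀, hi⟩ := mem_Ioo.1 hi
  have sign : (-1 : k) ^ i * (-1) ^ (i - 1) = -1 := by
    rw [← pow_add]
    exact Odd.neg_one_pow ⟨i - 1, by lia⟩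
  rw [cast_choose_prime_div hp hi₀ hi, neg_pow x, div_pow, pow_sub₀ y hy hi.le]
  linear_combination (x ^ i * (y ^ p * (y ^ i)⁻¹) / (i : k)) * sign

/-- Kontsevich's four-term functional equation:
`£₁(r) − £₁(s) + r^p·£₁(s/r) + (s−1)^p·£₁((1−r)/(1−s)) = 0`. -/
theorem kontsevichLog_four_term (p : ℕ) (hp : p.Prime) (hodd : Odd p)
    (k : Type*) [Field k] [CharP k p] (r s : k)
    (h : r * (1 - r) * (s * (1 - s)) * (s - r) ≠ 0) :
    kontsevichLog p r - kontsevichLog p s + r ^ p * kontsevichLog p (s / r)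
      + (s - 1) ^ p * kontsevichLog p ((1 - r) / (1 - s)) = 0 := by
  have hr : r ≠ 0 := by rintro rfl; simp at h
  have hs : 1 - s ≠ 0 := by intro hs; simp [hs] at h
  have log_eq (x : k) : kontsevichLog p x = -fermatCocycle p (-x) 1 := by
    simpa using pow_mul_kontsevichLog_div hp x one_ne_zero
  rw [← neg_sub 1 s, hodd.neg_pow, neg_mul, pow_mul_kontsevichLog_div hp _ hr,
    pow_mul_kontsevichLog_div hp _ hs, log_eq, log_eq]
  linear_combination -fermatCocycle_four_term hp hodd r s
end

section
/- Let p be an odd prime and k a field of characteristic p. For every y = s + αt ∈ k₂ with s(1−s) ≠ 0 (so that y ∈ k₂^♭, y is a unit of k₂, and y⁻¹ = s⁻¹ − s⁻²αt also lies in k₂^♭), one has ℓi₂^{(p)}(y⁻¹) + ℓi₂^{(p)}(y) = 0. -/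
open TrivSqZeroExt

/-- The characteristic-`p` infinitesimal dilogarithm `ℓi₂^{(p)}(s + αt) = (α/(s(1−s)))^p · £₁(s)`
on the dual numbers `k₂ = k[t]/(t²)`. -/
noncomputable def li2p (p : ℕ) {k : Type*} [Field k] (y : DualNumber k) : k :=
  (y.snd / (y.fst * (1 - y.fst))) ^ p * kontsevichLog p y.fst

/-- The inversion relation `s^p £₁(s⁻¹) = -£₁(s)` in characteristic `p`. -/
theorem pow_mul_kontsevichLog_inv (p : ℕ) {k : Type*} [Field k] [CharP k p] {s : k} (hs : s ≠ 0) :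
    s ^ p * kontsevichLog p s⁻¹ = -kontsevichLog p s := by
  unfold kontsevichLog
  rw [Finset.mul_sum, ← Finset.sum_neg_distrib]
  refine Finset.sum_nbij' (fun i => p - i) (fun i => p - i) ?_ ?_ ?_ ?_ ?_
  · intro i hi
    simp only [Finset.mem_Icc] at hi ⊢
    omega
  · intro i hi
    simp only [Finset.mem_Icc] at hi ⊢
    omega
  · intro i hi
    simp only [Finset.mem_Icc] at hi
    omega
  · intro i hi
    simp only [Finset.mem_Icc] at hi
    omega
  · intro i hi
    have hip : i ≤ p := by
      simp only [Finset.mem_Icc] at hi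
      omega
    rw [Nat.cast_sub hip, CharP.cast_eq_zero k p, zero_sub, div_neg, neg_neg, pow_sub₀ s hs hip,
      inv_pow, mul_div_assoc]

/-- For `y = s + αt ∈ k₂^♭` one has `ℓi₂^{(p)}(y⁻¹) + ℓi₂^{(p)}(y) = 0`. -/
theorem li2p_inv_add_li2p (p : ℕ) (hp : p.Prime) (hodd : Odd p)
    (k : Type*) [Field k] [CharP k p] (s α : k) (hs : s * (1 - s) ≠ 0) :
    li2p p ((inl s + inr α : DualNumber k)⁻¹) + li2p p (inl s + inr α : DualNumber k) = 0 := by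
  have hs0 : s ≠ 0 := left_ne_zero_of_mul hs
  have hs1 : 1 - s ≠ 0 := right_ne_zero_of_mul hs
  have hbar : (inl s + inr α : DualNumber k)⁻¹.snd / (s⁻¹ * (1 - s⁻¹)) =
      α / (s * (1 - s)) * s := by
    have hs1' : s - 1 ≠ 0 := by rwa [← neg_sub, neg_ne_zero]
    have hsnd : (inl s + inr α : DualNumber k)⁻¹.snd = -(s⁻¹ * α * s⁻¹) := by
      simp [snd_inv, mul_comm, mul_left_comm]
    rw [hsnd]
    field_simp
    ring
  have hfst : (inl s + inr α : DualNumber k)⁻¹.fst = s⁻¹ := by simp [fst_inv]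
  simp only [li2p, hfst, hbar, fst_add, snd_add, fst_inl, snd_inl, fst_inr, snd_inr, add_zero,
    zero_add]
  rw [mul_pow, mul_assoc, pow_mul_kontsevichLog_inv p hs0]
  ring
end

section
/- (Five-term relation for the characteristic-p infinitesimal dilogarithm.) Let p be an odd prime and k a field of characteristic p. For all x, y ∈ k₂^♭ such that y − x is a unit of k₂ = k[t]/(t²) (which guarantees that y/x, (1−x⁻¹)/(1−y⁻¹) and (1−x)/(1−y) all lie in k₂^♭), one has ℓi₂^{(p)}(x) − ℓi₂^{(p)}(y) + ℓi₂^{(p)}(y/x) − ℓi₂^{(p)}((1−x⁻¹)/(1−y⁻¹)) + ℓi₂^{(p)}((1−x)/(1−y)) = 0. -/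
open TrivSqZeroExt

/-- `y = s + αt ∈ k₂` lies in `k₂^♭` iff `s(1−s) ≠ 0`. -/
def IsFlat {k : Type*} [Field k] (y : DualNumber k) : Prop :=
  y.fst * (1 - y.fst) ≠ 0

/-- The integral polynomial `((x + y) ^ p - x ^ p - y ^ p) / p`, evaluated in a commutative ring. -/
def frobeniusDefect (p : ℕ) {R : Type*} [CommRing R] (x y : R) : R :=
  ∑ i ∈ Finset.Ioo 0 p, x ^ i * y ^ (p - i) * ((p.choose i / p : ℕ) : R)

section frobeniusDefect

variable {R S : Type*} [CommRing R] [CommRing S] {p : ℕ}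

theorem natCast_mul_frobeniusDefect (hp : p.Prime) (x y : R) :
    (p : R) * frobeniusDefect p x y = (x + y) ^ p - x ^ p - y ^ p := by
  rw [add_pow_prime_eq' hp, frobeniusDefect]
  ring

theorem map_frobeniusDefect (f : R →+* S) (x y : R) :
    f (frobeniusDefect p x y) = frobeniusDefect p (f x) (f y) := by
  simp [frobeniusDefect]

theorem frobeniusDefect_mul_mul (c x y : R) :
    frobeniusDefect p (c * x) (c * y) = c ^ p * frobeniusDefect p x y := by
  simp only [frobeniusDefect, Finset.mul_sum]
  refine Finset.sum_congr rfl fun i hi => ?_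
  have h : c ^ p = c ^ i * c ^ (p - i) := by
    rw [← pow_add, Nat.add_sub_cancel' (Finset.mem_Ioo.1 hi).2.le]
  rw [h]
  ring

theorem frobeniusDefect_comm (x y : R) : frobeniusDefect p x y = frobeniusDefect p y x := by
  refine Finset.sum_nbij' (p - ·) (p - ·) ?_ ?_ ?_ ?_ ?_ <;> intro i hi <;>
    rw [Finset.mem_Ioo] at hi
  · exact Finset.mem_Ioo.2 (by lia)
  · exact Finset.mem_Ioo.2 (by lia)
  · lia
  · lia
  · rw [Nat.sub_sub_self hi.2.le, Nat.choose_symm hi.2.le]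
    ring

theorem frobeniusDefect_neg_right (hodd : Odd p) (x y : R) :
    frobeniusDefect p x (-y) = -frobeniusDefect p y (-x) := by
  have h := frobeniusDefect_mul_mul (p := p) (-1) y (-x)
  rw [hodd.neg_one_pow, frobeniusDefect_comm] at h
  simpa using h

/-- The identity behind the coefficient of the first variable in the five-term relation. -/
theorem frobeniusDefect_six_term (hp : p.Prime) (hodd : Odd p) (a b : R) :
    frobeniusDefect p a (a * -a) - frobeniusDefect p b (b * -a) - frobeniusDefect p a (-b)
      + frobeniusDefect p (a * a) (a * -b) + frobeniusDefect p (a * (1 - b)) (-(b * (1 - a)))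
      - frobeniusDefect p (a * (1 - b)) (a * -(1 - a)) = 0 := by
  have key : ∀ a b : MvPolynomial (Fin 2) ℤ,
      frobeniusDefect p a (a * -a) - frobeniusDefect p b (b * -a) - frobeniusDefect p a (-b)
      + frobeniusDefect p (a * a) (a * -b) + frobeniusDefect p (a * (1 - b)) (-(b * (1 - a)))
      - frobeniusDefect p (a * (1 - b)) (a * -(1 - a)) = 0 := by
    intro a b
    have hp0 : (p : MvPolynomial (Fin 2) ℤ) ≠ 0 := Nat.cast_ne_zero.2 hp.ne_zero
    refine (mul_eq_zero_iff_left hp0).1 ?_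
    simp only [mul_sub, mul_add, natCast_mul_frobeniusDefect hp]
    have e₁ : a * 1 - a * b + -(b * 1 - b * a) = a + -b := by ring
    have e₂ : a * 1 - a * b + a * -(1 - a) = a * a + a * -b := by ring
    have e₃ : a * -(1 - a) = -(a + a * -a) := by ring
    have e₄ : b * 1 - b * a = b + b * -a := by ring
    have e₅ : b * -a = a * -b := by ring
    have e₆ : a * -a = -(a * a) := by ring
    rw [e₁, e₂, e₃, e₄, e₅, e₆]
    simp only [hodd.neg_pow]
    ring
  have h := congrArg (MvPolynomial.aeval (R := ℤ) ![a, b]).toRingHom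
    (key (MvPolynomial.X 0) (MvPolynomial.X 1))
  simp only [map_add, map_sub, map_frobeniusDefect] at h
  simpa using h

/-- The four-term relation for `£₁`, cleared of denominators. -/
theorem frobeniusDefect_four_term (hp : p.Prime) (hodd : Odd p) (a b : R) :
    (a ^ p - b ^ p) * frobeniusDefect p 1 (-a) - (1 - a ^ p) * frobeniusDefect p a (-b)
      + frobeniusDefect p (a * (1 - b)) (-(b * (1 - a)))
      - a ^ p * frobeniusDefect p (1 - b) (-(1 - a)) = 0 := by
  have h := frobeniusDefect_six_term hp hodd a b
  have h₁ := frobeniusDefect_mul_mul (p := p) a 1 (-a)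
  have h₂ := frobeniusDefect_mul_mul (p := p) b 1 (-a)
  rw [mul_one] at h₁ h₂
  rw [h₁, h₂, frobeniusDefect_mul_mul, frobeniusDefect_mul_mul] at h
  linear_combination h

end frobeniusDefect

section CharP

variable {k : Type*} [Field k] {p : ℕ} [CharP k p]

theorem natCast_choose_pred_of_charP (hp : p.Prime) {i : ℕ} (hi : i < p) :
    ((p - 1).choose i : k) = (-1) ^ i := by
  induction i with
  | zero => simp
  | succ i ih =>
    have h : (p - 1).choose i + (p - 1).choose (i + 1) = p.choose (i + 1) := by
      conv_rhs => rw [← Nat.sub_add_cancel hp.one_le]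
      rw [Nat.choose_succ_succ]
    have hz : ((p.choose (i + 1) : ℕ) : k) = 0 :=
      (CharP.cast_eq_zero_iff k p _).2 (hp.dvd_choose_self (Nat.succ_ne_zero i) hi)
    rw [← h, Nat.cast_add, ih (by lia)] at hz
    rw [pow_succ]
    linear_combination hz

theorem natCast_choose_div_of_charP (hp : p.Prime) {i : ℕ} (hi₀ : 0 < i) (hi : i < p) :
    ((p.choose i / p : ℕ) : k) = -(-1) ^ i / i := by
  have hik : (i : k) ≠ 0 := fun h =>
    Nat.not_dvd_of_pos_of_lt hi₀ hi ((CharP.cast_eq_zero_iff k p i).1 h)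
  obtain ⟨j, rfl⟩ : ∃ j, i = j + 1 := ⟨i - 1, by lia⟩
  obtain ⟨c, hc⟩ := hp.dvd_choose_self hi₀.ne' hi
  have h := Nat.add_one_mul_choose_eq (p - 1) j
  rw [Nat.sub_add_cancel hp.one_le, hc, mul_assoc] at h
  have h' := congrArg (Nat.cast : ℕ → k) (Nat.eq_of_mul_eq_mul_left hp.pos h)
  rw [natCast_choose_pred_of_charP hp (by lia), Nat.cast_mul] at h'
  rw [hc, Nat.mul_div_cancel_left _ hp.pos, eq_div_iff hik, ← h']
  ring

theorem kontsevichLog_div (hp : p.Prime) (hodd : Odd p) {u : k} (hu : u ≠ 0) (v : k) :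
    kontsevichLog p (v / u) = -frobeniusDefect p u (-v) / u ^ p := by
  have hIcc : Finset.Icc 1 (p - 1) = Finset.Ioo 0 p := by
    ext i
    simp only [Finset.mem_Icc, Finset.mem_Ioo]
    have := hp.one_lt
    lia
  rw [frobeniusDefect_neg_right hodd, neg_neg, kontsevichLog, frobeniusDefect, hIcc,
    Finset.sum_div]
  refine Finset.sum_congr rfl fun i hi => ?_
  obtain ⟨hi₀, hi⟩ := Finset.mem_Ioo.1 hi
  have hsign : (-1 : k) ^ (p - i) * -(-1) ^ i = 1 := by
    rw [mul_neg, ← pow_add, Nat.sub_add_cancel hi.le, hodd.neg_one_pow, neg_neg]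
  have hpow : u ^ p = u ^ (p - i) * u ^ i := by rw [← pow_add, Nat.sub_add_cancel hi.le]
  have hik : (i : k) ≠ 0 := fun h =>
    Nat.not_dvd_of_pos_of_lt hi₀ hi ((CharP.cast_eq_zero_iff k p i).1 h)
  rw [natCast_choose_div_of_charP hp hi₀ hi, neg_pow, hpow, div_pow]
  field_simp
  linear_combination -v ^ i * hsign

theorem li2p_of_fst_eq_div (hp : p.Prime) (hodd : Odd p) {z : DualNumber k} {u v w d : k}
    (hu : u ≠ 0) (hv : v ≠ 0) (hw : w ≠ 0) (huv : u - v = w) (hfst : z.fst = v / u)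
    (hsnd : z.snd = v / u * d) :
    li2p p z = -(d / w) ^ p * frobeniusDefect p u (-v) := by
  have h : z.snd / (z.fst * (1 - z.fst)) = u * (d / w) := by
    rw [hsnd, hfst, one_sub_div hu, huv]
    field_simp
  rw [li2p, h, hfst, kontsevichLog_div hp hodd hu, mul_pow]
  field_simp

end CharP

/-- The five-term (pentagon) relation for the characteristic-`p` infinitesimal dilogarithm. -/
theorem li2p_pentagon (p : ℕ) (hp : p.Prime) (hodd : Odd p)
    (k : Type*) [Field k] [CharP k p] (x y : DualNumber k)
    (hx : IsFlat x) (hy : IsFlat y) (hxy : IsUnit (y - x)) :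
    li2p p x - li2p p y + li2p p (y * x⁻¹)
      - li2p p ((1 - x⁻¹) * (1 - y⁻¹)⁻¹) + li2p p ((1 - x) * (1 - y)⁻¹) = 0 := by
  obtain ⟨hx₀, hx₁⟩ := mul_ne_zero_iff.1 hx
  obtain ⟨hy₀, hy₁⟩ := mul_ne_zero_iff.1 hy
  have hyx : y.fst - x.fst ≠ 0 := by
    simpa using (isUnit_iff_isUnit_fst.1 hxy).ne_zero
  have := Fact.mk hp
  generalize ha : x.fst = a at *
  generalize hb : y.fst = b at *
  generalize hα : x.snd = α at *
  generalize hβ : y.snd = β at *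
  have hab : a - b ≠ 0 := sub_ne_zero.2 (sub_ne_zero.1 hyx).symm
  have hx₁' : a - 1 ≠ 0 := sub_ne_zero.2 (sub_ne_zero.1 hx₁).symm
  have hy₁' : b - 1 ≠ 0 := sub_ne_zero.2 (sub_ne_zero.1 hy₁).symm
  have hinv : 1 - a⁻¹ = (a - 1) / a := by field_simp
  have hinv' : 1 - b⁻¹ = (b - 1) / b := by field_simp
  rw [li2p_of_fst_eq_div (z := x) (u := 1) (v := a) (d := α / a) hp hodd one_ne_zero hx₀ hx₁ rfl
      (by simp [ha]) (by rw [hα]; field_simp),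
    li2p_of_fst_eq_div (z := y) (u := 1) (v := b) (d := β / b) hp hodd one_ne_zero hy₀ hy₁ rfl
      (by simp [hb]) (by rw [hβ]; field_simp),
    li2p_of_fst_eq_div (z := y * x⁻¹) (d := β / b - α / a) hp hodd hx₀ hy₀ hab rfl
      (by simp [ha, hb, div_eq_mul_inv])
      (by simp [ha, hb, hα, hβ]; field_simp; ring),
    li2p_of_fst_eq_div (z := (1 - x⁻¹) * (1 - y⁻¹)⁻¹)
      (d := β / (b * (1 - b)) - α / (a * (1 - a))) hp hodd
      (mul_ne_zero hx₀ hy₁) (mul_ne_zero hy₀ hx₁) hab (by ring)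
      (by simp [ha, hb, hinv, hinv']; field_simp; ring)
      (by simp [ha, hb, hα, hβ, hinv, hinv']; field_simp; ring),
    li2p_of_fst_eq_div (z := (1 - x) * (1 - y)⁻¹) (w := a - b) (d := β / (1 - b) - α / (1 - a))
      hp hodd hy₁ hx₁ hab (by ring)
      (by simp [ha, hb, div_eq_mul_inv])
      (by simp [ha, hb, hα, hβ]; field_simp; ring)]
  have hA := pow_ne_zero p hx₀
  have hB := pow_ne_zero p hy₀
  have hA₁ := pow_ne_zero p hx₁
  have hB₁ := pow_ne_zero p hy₁
  have hAB := pow_ne_zero p hab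
  have h₁ := frobeniusDefect_four_term hp hodd a b
  have h₂ := frobeniusDefect_four_term hp hodd b a
  rw [frobeniusDefect_neg_right hodd b a,
    frobeniusDefect_neg_right hodd (b * (1 - a)) (a * (1 - b)),
    frobeniusDefect_neg_right hodd (1 - a) (1 - b)] at h₂
  simp only [div_pow, mul_pow, sub_pow_char, one_pow] at hA₁ hB₁ hAB ⊢
  generalize a ^ p = A at *
  generalize b ^ p = B at *
  generalize α ^ p = u at *
  generalize β ^ p = v at *
  field_simp
  linear_combination -u * B * (1 - B) * h₁ - v * A * (1 - A) * h₂
end
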